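/- There is a function f : ℕ → ℕ such that the following holds: let G be a finite group, p a prime, P a p-subgroup of G, and g ∈ G an element of order coprime to p that normalizes P. If g has a right Engel sink of cardinality at most m, then the subgroup [P,g] generated by all commutators [v,g] with v ∈ P has order at most f(m). -/

import Mathlib

/-- The commutator `[a,b] = a⁻¹ b⁻¹ a b`. -/
def cmtr {G : Type*} [Group G] (a b : G) : G := a⁻¹ * b⁻¹ * a * b

/-- `engel a b n` is the left-normed Engel commutator `[a,_n b] = [[...[[a,b],b],...],b]`
with `b` repeated `n` times. -/
def engel {G : Type*} [Group G] (a b : G) : ℕ → G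
  | 0 => a
  | n + 1 => cmtr (engel a b n) b

/-- A finite subset `R` of `G` is a right Engel sink for `g` if for every `x ∈ G` there is a
positive integer `n₀` such that `[g,_n x] ∈ R` for all `n ≥ n₀`. -/
def IsRightEngelSink {G : Type*} [Group G] (g : G) (R : Set G) : Prop :=
  R.Finite ∧ ∀ x : G, ∃ n₀ : ℕ, 0 < n₀ ∧ ∀ n ≥ n₀, engel g x n ∈ R

/-- A finite subset `E` of `G` is a left Engel sink for `g` if for every `x ∈ G` there is a
positive integer `n₀` such that `[x,_n g] ∈ E` for all `n ≥ n₀`. -/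
def IsLeftEngelSink {G : Type*} [Group G] (g : G) (E : Set G) : Prop :=
  E.Finite ∧ ∀ x : G, ∃ n₀ : ℕ, 0 < n₀ ∧ ∀ n ≥ n₀, engel x g n ∈ E

/-- An element is almost right Engel if it admits a finite right Engel sink. -/
def AlmostRightEngel {G : Type*} [Group G] (g : G) : Prop :=
  ∃ R : Set G, IsRightEngelSink g R

/-- A group is locally nilpotent if every finitely generated subgroup is nilpotent. -/
def LocallyNilpotent (G : Type*) [Group G] : Prop :=
  ∀ H : Subgroup G, H.FG → Group.IsNilpotent H

universe u

theorem IsRightEngelSink.one_mem {G : Type*} [Group G] {g : G} {R : Set G}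
    (h : IsRightEngelSink g R) : (1 : G) ∈ R := by
  obtain ⟨n, hn, h⟩ := h.2 1
  obtain ⟨k, rfl⟩ := Nat.exists_eq_succ_of_ne_zero hn.ne'
  simpa [engel, cmtr] using h _ le_rfl

theorem map_engel {G H : Type*} [Group G] [Group H] (f : G →* H) (a b : G) (n : ℕ) :
    f (engel a b n) = engel (f a) (f b) n := by
  induction n with
  | zero => rfl
  | succ n ih => simp [engel, cmtr, ih]

theorem IsRightEngelSink.map {G H : Type*} [Group G] [Group H] {g : G} {R : Set G}
    (h : IsRightEngelSink g R) (f : G →* H) (hf : Function.Surjective f) :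
    IsRightEngelSink (f g) (f '' R) := by
  refine ⟨h.1.image f, fun y ↦ ?_⟩
  obtain ⟨x, rfl⟩ := hf y
  obtain ⟨n₀, h0, hn⟩ := h.2 x
  exact ⟨n₀, h0, fun n hle ↦ ⟨_, hn n hle, map_engel f g x n⟩⟩

theorem IsRightEngelSink.comap {G H : Type*} [Group G] [Group H] {g : G} {f : G →* H} {R : Set H}
    (h : IsRightEngelSink (f g) R) (hf : Function.Injective f) :
    IsRightEngelSink g (f ⁻¹' R) := by
  refine ⟨h.1.preimage hf.injOn, fun x ↦ ?_⟩
  obtain ⟨n₀, h0, hn⟩ := h.2 (f x)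
  exact ⟨n₀, h0, fun n hle ↦ by simpa [map_engel] using hn n hle⟩

/-- A finite abelian subgroup normalized by `g`, on which `a ↦ [a,g]` is injective, is contained
in every right Engel sink of `g`. -/
theorem IsRightEngelSink.subset_of_abelian {G : Type*} [Group G] {g : G} {R : Set G}
    (h : IsRightEngelSink g R) (A : Subgroup G) [Finite A]
    (hcomm : ∀ a ∈ A, ∀ b ∈ A, a * b = b * a) (hg : ∀ a ∈ A, g⁻¹ * a * g ∈ A)
    (hinj : Set.InjOn (fun a ↦ cmtr a g) A) : (A : Set G) ⊆ R := by
  have hD : ∀ a ∈ A, cmtr a g ∈ A := fun a ha ↦ by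
    have := A.mul_mem (A.inv_mem ha) (hg a ha)
    simpa [cmtr, mul_assoc] using this
  let D : A → A := fun a ↦ ⟨cmtr a g, hD a a.2⟩
  have hDinj : Function.Injective D := fun a b hab ↦
    Subtype.ext (hinj a.2 b.2 (congrArg Subtype.val hab))
  let E : A → A := fun a ↦ ⟨g⁻¹ * (cmtr (a : G) g)⁻¹ * g, hg _ (A.inv_mem (hD a a.2))⟩
  have hEinj : Function.Injective E := fun a b hab ↦ by
    have := congrArg Subtype.val hab
    simp only [E, mul_left_inj, mul_right_inj, inv_inj] at this
    exact Subtype.ext (hinj a.2 b.2 this)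
  have key : ∀ (a : A) (n : ℕ), engel g (a * g : G) (n + 1) = (D^[n] (E a) : A) := by
    intro a n
    induction n with
    | zero => simp [engel, cmtr, E, mul_assoc]
    | succ n ih =>
      rw [engel, ih, Function.iterate_succ_apply']
      generalize D^[n] (E a) = u
      have := hcomm _ u.2 _ a.2
      simp only [D, cmtr, mul_inv_rev]
      calc (u : G)⁻¹ * (g⁻¹ * (a : G)⁻¹) * u * (a * g)
          = (u : G)⁻¹ * g⁻¹ * (a : G)⁻¹ * (u * a) * g := by group
        _ = (u : G)⁻¹ * g⁻¹ * u * g := by rw [this]; group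
  choose N hN0 hN using fun a : A ↦ h.2 (a * g : G)
  obtain ⟨M, hM⟩ := (Set.finite_range N).bddAbove
  have hsurj : Function.Surjective (D^[M] ∘ E) :=
    Finite.surjective_of_injective ((hDinj.iterate M).comp hEinj)
  intro b hb
  obtain ⟨a, ha⟩ := hsurj ⟨b, hb⟩
  have := hN a (M + 1) ((hM ⟨a, rfl⟩).trans (Nat.le_succ M))
  rw [key] at this
  rwa [show D^[M] (E a) = ⟨b, hb⟩ from ha] at this

/-- If the commutators `[a,g]` generate an abelian finite group `A`, then `a ↦ [a,g]` is injective
on `A`. -/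
theorem injOn_cmtr_of_le_closure {G : Type*} [Group G] {g : G} (A : Subgroup G) [Finite A]
    (hcomm : ∀ a ∈ A, ∀ b ∈ A, a * b = b * a) (hg : ∀ a ∈ A, g⁻¹ * a * g ∈ A)
    (hA : A ≤ Subgroup.closure {z | ∃ v ∈ A, z = cmtr v g}) :
    Set.InjOn (fun a ↦ cmtr a g) A := by
  have hD : ∀ a ∈ A, cmtr a g ∈ A := fun a ha ↦ by
    have := A.mul_mem (A.inv_mem ha) (hg a ha)
    simpa [cmtr, mul_assoc] using this
  let D : A →* A := MonoidHom.mk' (fun a ↦ ⟨cmtr a g, hD a a.2⟩) fun a b ↦ by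
    refine Subtype.ext ?_
    have := hcomm _ (A.inv_mem b.2) _ (hD a a.2)
    simp only [cmtr, Subgroup.coe_mul, mul_inv_rev] at this ⊢
    calc (b : G)⁻¹ * (a : G)⁻¹ * g⁻¹ * (a * b) * g
        = (b : G)⁻¹ * ((a : G)⁻¹ * g⁻¹ * a * g) * (g⁻¹ * b * g) := by group
      _ = (a : G)⁻¹ * g⁻¹ * a * g * ((b : G)⁻¹ * g⁻¹ * b * g) := by rw [this]; group
  have hsurj : Function.Surjective D := by
    intro b
    have hle : Subgroup.closure {z | ∃ v ∈ A, z = cmtr v g} ≤ D.range.map A.subtype := by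
      rw [Subgroup.closure_le]
      rintro _ ⟨v, hv, rfl⟩
      exact ⟨D ⟨v, hv⟩, ⟨_, rfl⟩, rfl⟩
    obtain ⟨_, ⟨a, rfl⟩, hb⟩ := hle (hA b.2)
    exact ⟨a, Subtype.ext hb⟩
  have hinj := Finite.injective_iff_surjective.2 hsurj
  intro a ha b hb hab
  exact congrArg Subtype.val (@hinj ⟨a, ha⟩ ⟨b, hb⟩ (Subtype.ext hab))

theorem IsPGroup.eq_one_of_pow_eq_one {G : Type*} [Group G] {p : ℕ} {P : Subgroup G}
    (hP : IsPGroup p P) {z : G} (hz : z ∈ P) {k : ℕ} (hk : Nat.Coprime k p) (h : z ^ k = 1) :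
    z = 1 := by
  obtain ⟨j, hj⟩ := hP ⟨z, hz⟩
  have hj' : z ^ p ^ j = 1 := congrArg Subtype.val hj
  exact orderOf_eq_one_iff.1 (Nat.eq_one_of_dvd_coprimes (hk.pow_right j)
    (orderOf_dvd_of_pow_eq_one h) (orderOf_dvd_of_pow_eq_one hj'))

open scoped commutatorElement in
theorem card_commutatorSet_le {G : Type*} [Group G] [Finite G] :
    Nat.card (commutatorSet G) ≤ (Subgroup.center G).index ^ 2 := by
  set Z := Subgroup.center G
  have hc : ∀ z ∈ Z, ∀ x, x * z = z * x := fun z hz x ↦ Subgroup.mem_center_iff.1 hz x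
  have key : ∀ a b : G, ⁅((a : G ⧸ Z).out), ((b : G ⧸ Z).out)⁆ = ⁅a, b⁆ := by
    intro a b
    obtain ⟨z, hz⟩ := QuotientGroup.mk_out_eq_mul Z a
    obtain ⟨w, hw⟩ := QuotientGroup.mk_out_eq_mul Z b
    have e1 := fun x ↦ hc z z.2 x
    have e2 := fun x ↦ hc w w.2 x
    rw [hz, hw]
    have e3 : ⁅a * (z : G), b * (w : G)⁆ = ⁅a, b * (w : G)⁆ := by
      simp only [commutatorElement_def, mul_inv_rev]
      calc a * (z : G) * (b * w) * ((z : G)⁻¹ * a⁻¹) * ((w : G)⁻¹ * b⁻¹)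
          = a * (z * (b * w)) * ((z : G)⁻¹ * a⁻¹) * ((w : G)⁻¹ * b⁻¹) := by group
        _ = a * (b * w) * a⁻¹ * ((w : G)⁻¹ * b⁻¹) := by rw [← e1]; group
    rw [e3]
    simp only [commutatorElement_def, mul_inv_rev]
    calc a * (b * (w : G)) * a⁻¹ * ((w : G)⁻¹ * b⁻¹)
        = a * b * (w * a⁻¹) * ((w : G)⁻¹ * b⁻¹) := by group
      _ = a * b * a⁻¹ * b⁻¹ := by rw [← e2]; group
  let F : (G ⧸ Z) × (G ⧸ Z) → commutatorSet G := fun q ↦ ⟨⁅q.1.out, q.2.out⁆, _, _, rfl⟩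
  have hF : Function.Surjective F := by
    rintro ⟨_, a, b, rfl⟩
    exact ⟨(a, b), Subtype.ext (key a b)⟩
  have := Nat.card_le_card_of_surjective F hF
  rwa [Nat.card_prod, ← sq] at this

theorem card_commutator_le_of_index_center_le {G : Type*} [Group G] [Finite G] {k : ℕ}
    (h : (Subgroup.center G).index ≤ k) : Nat.card (commutator G) ≤ k ^ (k * k ^ 2 + 1) := by
  have h0 : 0 < (Subgroup.center G).index := Nat.pos_of_ne_zero Subgroup.index_ne_zero_of_finite
  refine (Nat.le_of_dvd (pow_pos h0 _) (Subgroup.card_commutator_dvd_index_center_pow G)).trans ?_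
  refine (Nat.pow_le_pow_left h _).trans (Nat.pow_le_pow_right (h0.trans_le h) ?_)
  have := card_commutatorSet_le (G := G)
  gcongr
  exact this.trans (Nat.pow_le_pow_left h 2)

/-- Let `G = Q⟨g⟩` with `Q = [Q,g]` a normal `p`-subgroup and `g` a `p'`-element. An element of `Q`
that is central modulo the centre of `G` is central. -/
theorem mem_center_of_cmtr_mem_center {G : Type*} [Group G] {p : ℕ} {Q : Subgroup G} [Q.Normal]
    (hQ : IsPGroup p Q) {g : G} (hcop : Nat.Coprime (orderOf g) p)
    (htop : Q ⊔ Subgroup.zpowers g = ⊤)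
    (hgen : Q ≤ Subgroup.closure {z | ∃ v ∈ Q, z = cmtr v g}) {n : G} (hn : n ∈ Q)
    (hnQ : ∀ v ∈ Q, cmtr n v ∈ Subgroup.center G) (hng : cmtr n g ∈ Subgroup.center G) :
    n ∈ Subgroup.center G := by
  have hzQ : cmtr n g ∈ Q := by
    have := Q.mul_mem (Q.inv_mem hn) (Subgroup.Normal.conj_mem' ‹Q.Normal› n hn g)
    simpa [cmtr, mul_assoc] using this
  have hconj : ∀ k : ℕ, (g ^ k)⁻¹ * n * g ^ k = n * cmtr n g ^ k := by
    intro k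
    induction k with
    | zero => simp
    | succ k ih =>
      have hz := Subgroup.mem_center_iff.1 (Subgroup.pow_mem _ hng k) g
      calc (g ^ (k + 1))⁻¹ * n * g ^ (k + 1) = g⁻¹ * ((g ^ k)⁻¹ * n * g ^ k) * g := by
            rw [pow_succ]; group
        _ = g⁻¹ * n * (cmtr n g ^ k * g) := by rw [ih]; group
        _ = g⁻¹ * n * g * cmtr n g ^ k := by rw [← hz]; group
        _ = n * cmtr n g * cmtr n g ^ k := by
            rw [show g⁻¹ * n * g = n * cmtr n g by simp only [cmtr]; group]
        _ = n * cmtr n g ^ (k + 1) := by rw [mul_assoc, ← pow_succ']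
  have hz1 : cmtr n g = 1 := by
    refine hQ.eq_one_of_pow_eq_one hzQ hcop ?_
    simpa [pow_orderOf_eq_one] using hconj (orderOf g)
  have hg : MulAut.conj n g = g := by
    have : n * g = g * n := by
      calc n * g = g * n * cmtr n g := by simp only [cmtr]; group
        _ = g * n := by rw [hz1, mul_one]
    rw [MulAut.conj_apply, this, mul_inv_cancel_right]
  have hv : ∀ v ∈ Q, MulAut.conj n (cmtr v g) = cmtr v g := by
    intro v hv
    have hw := fun x ↦ Subgroup.mem_center_iff.1 (hnQ v hv) x
    have hnv : MulAut.conj n v = v * cmtr n v := by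
      rw [MulAut.conj_apply, mul_inv_eq_iff_eq_mul, mul_assoc, ← hw]
      simp only [cmtr]; group
    rw [show MulAut.conj n (cmtr v g) = cmtr (v * cmtr n v) g by
      simp only [cmtr, map_mul, map_inv, hg] at hnv ⊢; rw [hnv]]
    generalize cmtr n v = w at hw
    calc (v * w)⁻¹ * g⁻¹ * (v * w) * g = w⁻¹ * v⁻¹ * (g⁻¹ * v * w) * g := by group
      _ = v⁻¹ * g⁻¹ * v * g := by
        rw [hw]
        calc w⁻¹ * v⁻¹ * (w * (g⁻¹ * v)) * g = w⁻¹ * (v⁻¹ * w) * g⁻¹ * v * g := by group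
          _ = v⁻¹ * g⁻¹ * v * g := by rw [hw]; group
  have hle : Q ⊔ Subgroup.zpowers g ≤ Subgroup.centralizer {n} := by
    have hmem : ∀ x, MulAut.conj n x = x → x ∈ Subgroup.centralizer {n} := by
      intro x hx
      rw [Subgroup.mem_centralizer_singleton_iff]
      rw [MulAut.conj_apply, mul_inv_eq_iff_eq_mul] at hx
      exact hx.symm
    refine sup_le (hgen.trans ?_) (Subgroup.zpowers_le.2 (hmem g hg))
    rw [Subgroup.closure_le]
    rintro _ ⟨v, hvQ, rfl⟩
    exact hmem _ (hv v hvQ)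
  rw [htop] at hle
  refine Subgroup.mem_center_iff.2 fun x ↦ ?_
  exact Subgroup.mem_centralizer_singleton_iff.1 (hle (Subgroup.mem_top x))

theorem map_le_closure_cmtr {G H : Type*} [Group G] [Group H] {Q : Subgroup G} {g : G}
    (hgen : Q ≤ Subgroup.closure {z | ∃ v ∈ Q, z = cmtr v g}) (f : G →* H) :
    Q.map f ≤ Subgroup.closure {z | ∃ v ∈ Q.map f, z = cmtr v (f g)} := by
  refine (Subgroup.map_mono hgen).trans ?_
  rw [MonoidHom.map_closure]
  refine Subgroup.closure_mono ?_
  rintro _ ⟨_, ⟨v, hv, rfl⟩, rfl⟩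
  exact ⟨f v, ⟨v, hv, rfl⟩, by simp [cmtr]⟩

theorem exists_card_bound_of_normal (m : ℕ) :
    ∃ B : ℕ, ∀ (G : Type u) [Group G] [Finite G] (p : ℕ), p.Prime → ∀ (Q : Subgroup G) [Q.Normal],
      IsPGroup p Q → ∀ g : G, Nat.Coprime (orderOf g) p → Q ⊔ Subgroup.zpowers g = ⊤ →
      Q ≤ Subgroup.closure {z | ∃ v ∈ Q, z = cmtr v g} →
      ∀ R : Set G, R.ncard ≤ m → IsRightEngelSink g R → Nat.card Q ≤ B := by
  induction m with
  | zero =>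
    refine ⟨0, fun G _ _ p _ Q _ _ g _ _ _ R hR hsink ↦ ?_⟩
    have := (Set.ncard_eq_zero hsink.1).1 (Nat.le_zero.1 hR)
    exact absurd hsink.one_mem (by simp [this])
  | succ m ih =>
    obtain ⟨B, hB⟩ := ih
    set k := (m + 1) * B
    refine ⟨(m + 1) * k ^ (k * k ^ 2 + 1) + 1,
      fun G _ _ p hp Q hQn hQ g hcop htop hgen R hR hsink ↦ ?_⟩
    have : Fact p.Prime := ⟨hp⟩
    by_cases hbot : Q = ⊥
    · subst hbot; simp
    refine le_trans ?_ (Nat.le_succ _)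
    let Z : Subgroup G := Q ⊓ Subgroup.center G
    let π := QuotientGroup.mk' Z
    have hπ : Function.Surjective π := QuotientGroup.mk'_surjective Z
    have hker : ∀ x, π x = 1 ↔ x ∈ Z := fun x ↦ QuotientGroup.eq_one_iff x
    have : (Q.map π).Normal := hQn.map π hπ
    let A : Subgroup (G ⧸ Z) := Q.map π ⊓ Subgroup.centralizer (Q.map π)
    have hA : A.Normal := inferInstance
    have hcomm : ∀ a ∈ A, ∀ b ∈ A, a * b = b * a := fun a ha b hb ↦
      (Subgroup.mem_centralizer_iff.1 ha.2 b hb.1).symm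
    have hcent : ∀ n ∈ Q, π n ∈ A → cmtr n g ∈ Z → n ∈ Z := by
      intro n hn hnA hng
      refine ⟨hn, mem_center_of_cmtr_mem_center hQ hcop htop hgen hn (fun v hv ↦ ?_) hng.2⟩
      have := Subgroup.mem_centralizer_iff.1 hnA.2 (π v) ⟨v, hv, rfl⟩
      refine ((hker _).1 ?_).2
      simp only [cmtr, map_mul, map_inv]
      rw [mul_assoc, ← this]
      group
    have hinj : Set.InjOn (fun a ↦ cmtr a (π g)) A := by
      intro a ha b hb hab
      have hc : a * b⁻¹ ∈ A := A.mul_mem ha (A.inv_mem hb)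
      obtain ⟨n, hn, hnc⟩ := hc.1
      have h1 : cmtr (a * b⁻¹) (π g) = 1 := by
        have hab' : (π g)⁻¹ * a * π g = a * b⁻¹ * ((π g)⁻¹ * b * π g) := by
          have := congrArg (a * ·) hab
          simpa [cmtr, mul_assoc] using this
        calc cmtr (a * b⁻¹) (π g)
            = (a * b⁻¹)⁻¹ * ((π g)⁻¹ * a * π g) * ((π g)⁻¹ * b * π g)⁻¹ := by
              simp only [cmtr]; group
          _ = 1 := by rw [hab']; group
      have hnZ : n ∈ Z := by
        refine hcent n hn (hnc ▸ hc) ((hker _).1 ?_)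
        rw [← h1, ← hnc]
        simp [cmtr]
      rw [← hker, hnc] at hnZ
      exact mul_inv_eq_one.1 hnZ
    have hAR : (A : Set (G ⧸ Z)) ⊆ π '' R :=
      (hsink.map π hπ).subset_of_abelian A hcomm
        (fun a ha ↦ hA.conj_mem' a ha (π g)) hinj
    have hAcard : Nat.card A ≤ m + 1 := by
      have := Set.ncard_le_ncard hAR (hsink.1.image π)
      exact this.trans ((Set.ncard_image_le hsink.1).trans hR)
    let N := A.comap π
    have hN : N.Normal := hA.comap π
    have hZN : Z ≤ N := fun z hz ↦ by
      change π z ∈ A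
      rw [(hker z).2 hz]
      exact A.one_mem
    have hNQ : N ≤ Q := by
      intro n hn
      obtain ⟨q, hq, hqn⟩ := (show π n ∈ A from hn).1
      have : q⁻¹ * n ∈ Z := by rw [← hker]; simp [hqn]
      simpa using Q.mul_mem hq this.1
    have hQbar : Nontrivial (Q.map π) := by
      rw [Subgroup.nontrivial_iff_ne_bot]
      intro h
      refine hbot (eq_bot_iff.2 (hgen.trans ?_))
      rw [Subgroup.closure_le]
      rintro _ ⟨v, hv, rfl⟩
      have hvZ : π v = 1 := by
        rw [← Subgroup.mem_bot, ← h]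
        exact ⟨v, hv, rfl⟩
      have := Subgroup.mem_center_iff.1 ((hker v).1 hvZ).2 g
      simp only [cmtr, SetLike.mem_coe, Subgroup.mem_bot]
      rw [mul_assoc, ← this]
      group
    obtain ⟨r, hrR, hrN, hr1⟩ : ∃ r ∈ R, r ∈ N ∧ r ≠ 1 := by
      have := (hQ.map π).center_nontrivial
      obtain ⟨c, hc⟩ := exists_ne (1 : Subgroup.center (Q.map π))
      have hcA : ((c : Q.map π) : G ⧸ Z) ∈ A := by
        refine ⟨c.1.2, Subgroup.mem_centralizer_iff.2 fun x hx ↦ ?_⟩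
        exact congrArg Subtype.val (Subgroup.mem_center_iff.1 c.2 ⟨x, hx⟩)
      obtain ⟨r, hr, hrc⟩ := hAR hcA
      refine ⟨r, hr, show π r ∈ A from hrc ▸ hcA, ?_⟩
      rintro rfl
      exact hc (Subtype.ext (Subtype.ext (by simpa using hrc.symm)))
    have hQN : N.relIndex Q ≤ B := by
      let φ := QuotientGroup.mk' N
      have hφ : Function.Surjective φ := QuotientGroup.mk'_surjective N
      have hlt : (φ '' R).ncard < R.ncard := by
        refine lt_of_le_of_ne (Set.ncard_image_le hsink.1) fun h ↦ hr1 ?_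
        refine (Set.ncard_image_iff hsink.1).1 h hrR hsink.one_mem ?_
        rw [map_one]
        exact (QuotientGroup.eq_one_iff r).2 hrN
      have : (Q.map φ).Normal := hQn.map φ hφ
      have := hB (G ⧸ N) p hp (Q.map φ) (hQ.map φ) (φ g)
        (hcop.coprime_dvd_left (orderOf_map_dvd φ g))
        (by rw [← MonoidHom.map_zpowers, ← Subgroup.map_sup, htop,
          Subgroup.map_top_of_surjective φ hφ])
        (map_le_closure_cmtr hgen φ) (φ '' R) (by omega) (hsink.map φ hφ)
      rwa [← Subgroup.relIndex_ker, QuotientGroup.ker_mk'] at this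
    have hZindex : (Subgroup.center Q).index ≤ k := by
      have h1 : Z.relIndex N = Nat.card A := by
        have := Subgroup.relIndex_ker (K := N) π
        rwa [QuotientGroup.ker_mk', Subgroup.map_comap_eq_self_of_surjective hπ] at this
      have h2 : Z.subgroupOf Q ≤ Subgroup.center Q := by
        intro z hz
        refine Subgroup.mem_center_iff.2 fun x ↦ Subtype.ext ?_
        exact Subgroup.mem_center_iff.1 (Subgroup.mem_subgroupOf.1 hz).2 x
      calc (Subgroup.center Q).index ≤ Z.relIndex Q := Subgroup.index_antitone h2
        _ = Z.relIndex N * N.relIndex Q := (Subgroup.relIndex_mul_relIndex _ _ _ hZN hNQ).symm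
        _ ≤ k := Nat.mul_le_mul (h1.trans_le hAcard) hQN
    have hab : (⁅Q, Q⁆).relIndex Q ≤ m + 1 := by
      let φ := QuotientGroup.mk' ⁅Q, Q⁆
      have hφ : Function.Surjective φ := QuotientGroup.mk'_surjective _
      have hn : (Q.map φ).Normal := hQn.map φ hφ
      have hc : ∀ a ∈ Q.map φ, ∀ b ∈ Q.map φ, a * b = b * a := by
        rintro _ ⟨a, ha, rfl⟩ _ ⟨b, hb, rfl⟩
        rw [← commutatorElement_eq_one_iff_mul_comm, ← map_commutatorElement]
        exact (QuotientGroup.eq_one_iff _).2 (Subgroup.commutator_mem_commutator ha hb)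
      have hg' : ∀ a ∈ Q.map φ, (φ g)⁻¹ * a * φ g ∈ Q.map φ := fun a ha ↦
        hn.conj_mem' a ha (φ g)
      have hsub := (hsink.map φ hφ).subset_of_abelian (Q.map φ) hc hg'
        (injOn_cmtr_of_le_closure _ hc hg' (map_le_closure_cmtr hgen φ))
      have hrel := Subgroup.relIndex_ker (K := Q) φ
      rw [QuotientGroup.ker_mk'] at hrel
      rw [hrel]
      exact (Set.ncard_le_ncard hsub (hsink.1.image φ)).trans
        ((Set.ncard_image_le hsink.1).trans hR)
    have hcard : Nat.card (⁅Q, Q⁆ : Subgroup G) = Nat.card (commutator Q) := by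
      rw [← Subgroup.map_subtype_commutator]
      exact Subgroup.card_map_of_injective Q.subtype_injective
    calc Nat.card Q = Nat.card (Subgroup.subgroupOf ⁅Q, Q⁆ Q) * (⁅Q, Q⁆).relIndex Q :=
          (Subgroup.card_mul_index _).symm
      _ = (⁅Q, Q⁆).relIndex Q * Nat.card (commutator Q) := by
          rw [Nat.card_congr (Subgroup.subgroupOfEquivOfLe (Subgroup.commutator_le_left Q Q)).toEquiv,
            hcard, mul_comm]
      _ ≤ (m + 1) * k ^ (k * k ^ 2 + 1) :=
          Nat.mul_le_mul hab (card_commutator_le_of_index_center_le hZindex)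

/-- Coprime action: `[P,g] = [P,g,g]` for a `p'`-element `g` normalizing a `p`-group `P`. -/
theorem closure_cmtr_le_closure_cmtr {G : Type*} [Group G] {p : ℕ} {P : Subgroup G}
    (hP : IsPGroup p P) {g : G} (hcop : Nat.Coprime (orderOf g) p)
    (hg : ∀ v ∈ P, g⁻¹ * v * g ∈ P) :
    Subgroup.closure {z | ∃ v ∈ P, z = cmtr v g} ≤
      Subgroup.closure
        {z | ∃ v ∈ Subgroup.closure {z | ∃ v ∈ P, z = cmtr v g}, z = cmtr v g} := by
  set Q := Subgroup.closure {z | ∃ v ∈ P, z = cmtr v g} with hQ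
  set K := Subgroup.closure {z | ∃ v ∈ Q, z = cmtr v g} with hK
  have hQP : Q ≤ P := by
    rw [hQ, Subgroup.closure_le]
    rintro _ ⟨v, hv, rfl⟩
    have := P.mul_mem (P.inv_mem hv) (hg v hv)
    simpa [cmtr, mul_assoc] using this
  have hKQ : K ≤ Q := Subgroup.closure_mono fun _ ⟨v, hv, h⟩ ↦ ⟨v, hQP hv, h⟩
  have hcK : ∀ v ∈ Q, cmtr v g ∈ K := fun v hv ↦ Subgroup.subset_closure ⟨v, hv, rfl⟩
  rw [hQ, Subgroup.closure_le]
  rintro _ ⟨v, hv, rfl⟩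
  have huQ : cmtr v g ∈ Q := Subgroup.subset_closure ⟨v, hv, rfl⟩
  have hconj : ∀ k : ℕ, ∃ c ∈ K, (g ^ k)⁻¹ * v * g ^ k = v * cmtr v g ^ k * c := by
    intro k
    induction k with
    | zero => exact ⟨1, K.one_mem, by simp⟩
    | succ k ih =>
      obtain ⟨c, hc, h⟩ := ih
      refine ⟨cmtr (cmtr v g ^ k) g * (c * cmtr c g),
        K.mul_mem (hcK _ (Q.pow_mem huQ k)) (K.mul_mem hc (hcK c (hKQ hc))), ?_⟩
      have hvg : g⁻¹ * v * g = v * cmtr v g := by simp only [cmtr]; group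
      rw [pow_succ' (cmtr v g)]
      generalize cmtr v g ^ k = w at *
      calc (g ^ (k + 1))⁻¹ * v * g ^ (k + 1) = g⁻¹ * ((g ^ k)⁻¹ * v * g ^ k) * g := by
            rw [pow_succ]; group
        _ = g⁻¹ * v * g * (g⁻¹ * w * g) * (g⁻¹ * c * g) := by rw [h]; group
        _ = v * cmtr v g * (g⁻¹ * w * g) * (g⁻¹ * c * g) := by rw [hvg]
        _ = v * (cmtr v g * w) * (cmtr w g * (c * cmtr c g)) := by simp only [cmtr]; group
  obtain ⟨c, hc, h⟩ := hconj (orderOf g)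
  have hpow : cmtr v g ^ orderOf g ∈ K := by
    have h1 : cmtr v g ^ orderOf g * c = 1 := by
      simpa [pow_orderOf_eq_one, mul_assoc] using h
    rw [eq_inv_of_mul_eq_one_left h1]
    exact K.inv_mem hc
  obtain ⟨j, hj⟩ := hP ⟨cmtr v g, hQP huQ⟩
  have hj' : cmtr v g ^ p ^ j = 1 := congrArg Subtype.val hj
  have hgcd : (orderOf g).gcd (orderOf (cmtr v g)) = 1 :=
    (hcop.pow_right j).coprime_dvd_right (orderOf_dvd_of_pow_eq_one hj')
  exact Subgroup.zpowers_le.2 hpow (mem_zpowers_pow_iff.2 hgcd)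

/-- If a `p'`-element `g` of a finite group normalizes a `p`-subgroup `P` and has a right
Engel sink of cardinality at most `m`, then the order of `[P,g]` is bounded in terms
of `m`. -/
theorem commutator_with_p_subgroup_bounded :
    ∃ f : ℕ → ℕ, ∀ (m : ℕ) (G : Type u) [Group G] [Finite G] (p : ℕ), p.Prime →
      ∀ P : Subgroup G, IsPGroup p P →
      ∀ g : G, Nat.Coprime (orderOf g) p → (∀ v ∈ P, g⁻¹ * v * g ∈ P) →
      (∃ R : Finset G, R.card ≤ m ∧ IsRightEngelSink g ↑R) →
      Nat.card (Subgroup.closure {z : G | ∃ v ∈ P, z = cmtr v g}) ≤ f m := by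
  choose B hB using exists_card_bound_of_normal.{u}
  refine ⟨B, fun m G _ _ p hp P hP g hcop hg ⟨R, hRm, hR⟩ ↦ ?_⟩
  have hgen := closure_cmtr_le_closure_cmtr hP hcop hg
  set Q := Subgroup.closure {z | ∃ v ∈ P, z = cmtr v g} with hQ
  have hQP : Q ≤ P := by
    rw [hQ, Subgroup.closure_le]
    rintro _ ⟨v, hv, rfl⟩
    have := P.mul_mem (P.inv_mem hv) (hg v hv)
    simpa [cmtr, mul_assoc] using this
  have hgQ : ∀ v ∈ Q, g⁻¹ * v * g ∈ Q := fun v hv ↦ by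
    have : v * cmtr v g ∈ Q := Q.mul_mem hv (Subgroup.subset_closure ⟨v, hQP hv, rfl⟩)
    simpa [cmtr, mul_assoc] using this
  let H := Q ⊔ Subgroup.zpowers g
  have hQH : Q ≤ H := le_sup_left
  have hgH : g ∈ H := Subgroup.mem_sup_right (Subgroup.mem_zpowers g)
  have hnorm : H ≤ Subgroup.normalizer Q := by
    refine sup_le Subgroup.le_normalizer (Subgroup.zpowers_le.2 ?_)
    rw [← inv_mem_iff]
    refine Subgroup.mem_normalizer_fintype fun v hv ↦ ?_
    simpa using hgQ v hv
  have : (Q.subgroupOf H).Normal := Subgroup.normal_subgroupOf_of_le_normalizer hnorm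
  have hmap : (Q.subgroupOf H).map H.subtype = Q := Subgroup.map_subgroupOf_eq_of_le hQH
  have hinj := Subgroup.map_injective H.subtype_injective
  have hbound := hB m H p hp (Q.subgroupOf H) ?_ ⟨g, hgH⟩ ?_ ?_ ?_
    (H.subtype ⁻¹' (R : Set G)) ?_ (IsRightEngelSink.comap hR H.subtype_injective)
  · rwa [Nat.card_congr (Subgroup.subgroupOfEquivOfLe hQH).toEquiv] at hbound
  · exact (hP.to_le hQP).comap_of_injective _ H.subtype_injective
  · rwa [← Subgroup.orderOf_coe]
  · apply hinj
    rw [Subgroup.map_sup, hmap, MonoidHom.map_zpowers, ← MonoidHom.range_eq_map,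
      Subgroup.range_subtype]
    rfl
  · rw [← Subgroup.map_le_map_iff_of_injective H.subtype_injective, hmap, MonoidHom.map_closure]
    refine hgen.trans (Subgroup.closure_mono ?_)
    rintro _ ⟨v, hv, rfl⟩
    exact ⟨_, ⟨⟨v, hQH hv⟩, hv, rfl⟩, rfl⟩
  · refine (Set.ncard_le_ncard_of_injOn H.subtype (fun x hx ↦ hx)
      H.subtype_injective.injOn R.finite_toSet).trans ?_
    rwa [Set.ncard_coe_finset]
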